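/- arXiv:2310.05734 — 4 statements merged into one kernel-verified Lean document; each statement's English description precedes it below -/
import Mathlib

section
/- Let $k$ be a field. For $s \in \mathbb{N}$ and a tuple $(m_1,\dots,m_s) \in \mathbb{N}^s$ (each $m_i \geq 1$) define the $k$-algebras $A = k[X,Y,Z]/(X^2,Y^2,Z^2,XY,XZ,YZ)$ and $A_{(m_1,\dots,m_s)} = k[X_1,\dots,X_s]/(X_1^{2^{m_1}},\dots,X_s^{2^{m_s}})$. Suppose $s,t \in \mathbb{N}$, $(m_1,\dots,m_s) \in \mathbb{N}^s$ with $m_1 \geq \dots \geq m_s \geq 1$ and $(n_1,\dots,n_t) \in \mathbb{N}^t$ with $n_1 \geq \dots \geq n_t \geq 1$. If $A_{(m_1,\dots,m_s)} \otimes_k A$ and $A_{(n_1,\dots,n_t)} \otimes_k A$ are isomorphic as $k$-algebras, then $s = t$ and $m_1 = n_1, \dots, m_s = n_s$. -/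
open MvPolynomial

/-- `A = k[X,Y,Z]/(X²,Y²,Z²,XY,XZ,YZ)`. -/
abbrev algA (k : Type*) [Field k] : Type _ :=
  MvPolynomial (Fin 3) k ⧸
    Ideal.span ({X 0 ^ 2, X 1 ^ 2, X 2 ^ 2, X 0 * X 1, X 0 * X 2, X 1 * X 2} :
      Set (MvPolynomial (Fin 3) k))

/-- `A_{(m₁,…,m_s)} = k[X₁,…,X_s]/(X₁^{2^{m₁}},…,X_s^{2^{m_s}})`. -/
abbrev algAm (k : Type*) [Field k] {s : ℕ} (m : Fin s → ℕ) : Type _ :=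
  MvPolynomial (Fin s) k ⧸
    Ideal.span (Set.range fun i : Fin s => (X i : MvPolynomial (Fin s) k) ^ 2 ^ m i)

open Module

section DegreeFiltration

variable {k R S ι κ : Type*} [Field k] [CommRing R] [Algebra k R] [CommRing S] [Algebra k S]

lemma card_filter_le_eq {α : Type*} [Fintype α] (g : α → ℕ) (n : ℕ) :
    (Finset.univ.filter fun i => n ≤ g i).card =
      (Finset.univ.filter fun i => n = g i).card +
        (Finset.univ.filter fun i => n + 1 ≤ g i).card := by
  classical
  rw [← Finset.card_union_of_disjoint]
  · congr 1
    ext i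
    simp only [Finset.mem_filter, Finset.mem_univ, true_and, Finset.mem_union]
    lia
  · rw [Finset.disjoint_filter]
    lia

/-- The span of the members of a family whose degree is at least `n`. -/
def degreeSpan (k : Type*) {R ι : Type*} [Field k] [CommRing R] [Algebra k R]
    (b : ι → R) (d : ι → ℕ) (n : ℕ) : Submodule k R :=
  Submodule.span k (b '' {i | n ≤ d i})

/-- A basis with degrees whose degree filtration is multiplicative and generated by its first
step. -/
structure IsAdicBasis (b : Basis ι k R) (d : ι → ℕ) : Prop where
  mul_mem : ∀ i j, b i * b j ∈ degreeSpan k b d (d i + d j)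
  mem_pow : ∀ i, b i ∈ degreeSpan k b d 1 ^ d i

lemma mem_degreeSpan (b : ι → R) (d : ι → ℕ) {n : ℕ} {i : ι} (h : n ≤ d i) :
    b i ∈ degreeSpan k b d n :=
  Submodule.subset_span ⟨i, h, rfl⟩

lemma degreeSpan_anti (b : ι → R) (d : ι → ℕ) : Antitone (degreeSpan k b d) := fun _ _ h =>
  Submodule.span_mono (Set.image_mono fun _ hi => le_trans h hi)

lemma Module.Basis.degreeSpan_zero (b : Basis ι k R) (d : ι → ℕ) : degreeSpan k b d 0 = ⊤ := by
  simp [degreeSpan, b.span_eq]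

namespace IsAdicBasis

variable {b : Basis ι k R} {d : ι → ℕ} {c : Basis κ k S} {e : κ → ℕ}

lemma degreeSpan_mul_le (hb : IsAdicBasis b d) (p q : ℕ) :
    degreeSpan k b d p * degreeSpan k b d q ≤ degreeSpan k b d (p + q) := by
  rw [degreeSpan, degreeSpan, Submodule.span_mul_span, Submodule.span_le]
  rintro _ ⟨_, ⟨i, hi, rfl⟩, _, ⟨j, hj, rfl⟩, rfl⟩
  exact degreeSpan_anti b d (add_le_add hi hj) (hb.mul_mem i j)

lemma degreeSpan_one_pow (hb : IsAdicBasis b d) {n : ℕ} (hn : n ≠ 0) :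
    degreeSpan k b d 1 ^ n = degreeSpan k b d n := by
  apply le_antisymm
  · induction n, Nat.one_le_iff_ne_zero.mpr hn using Nat.le_induction with
    | base => simp
    | succ n h ih =>
      rw [pow_succ]
      exact (mul_le_mul_left (ih (by lia)) _).trans (hb.degreeSpan_mul_le n 1)
  · have hsq : degreeSpan k b d 1 ^ 2 ≤ degreeSpan k b d 1 := by
      rw [pow_two]
      exact (hb.degreeSpan_mul_le 1 1).trans (degreeSpan_anti b d (by lia))
    have hanti : ∀ p, n ≤ p → degreeSpan k b d 1 ^ p ≤ degreeSpan k b d 1 ^ n := by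
      intro p hp
      induction p, hp using Nat.le_induction with
      | base => exact le_rfl
      | succ p h ih =>
        refine le_trans ?_ ih
        obtain ⟨q, rfl⟩ : ∃ q, p = q + 1 := ⟨p - 1, by lia⟩
        rw [add_assoc, pow_add, pow_succ]
        exact mul_le_mul_right hsq _
    rw [degreeSpan, Submodule.span_le]
    rintro _ ⟨i, hi, rfl⟩
    exact hanti _ hi (hb.mem_pow i)

lemma nilradical_eq [Finite ι] [Nontrivial R] (hb : IsAdicBasis b d) :
    (nilradical R).restrictScalars k = degreeSpan k b d 1 := by
  have hle : ∀ x ∈ degreeSpan k b d 1, IsNilpotent x := by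
    intro x hx
    obtain ⟨N, hN⟩ := (Set.finite_range d).bddAbove
    refine ⟨N + 1, ?_⟩
    have h := Submodule.pow_mem_pow _ hx (N + 1)
    rw [hb.degreeSpan_one_pow (by lia), degreeSpan] at h
    have hempty : {i | N + 1 ≤ d i} = ∅ := by
      ext i
      have := hN ⟨i, rfl⟩
      simp only [Set.mem_ofPred_eq, Set.mem_empty_iff_false, iff_false]
      lia
    rw [hempty] at h
    simpa using h
  apply le_antisymm
  · intro x hx
    have hsup : (⊤ : Submodule k R) ≤ 1 ⊔ degreeSpan k b d 1 := by
      rw [← b.span_eq, Submodule.span_le]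
      rintro _ ⟨i, rfl⟩
      rcases Nat.eq_zero_or_pos (d i) with h | h
      · have := hb.mem_pow i
        rw [h, pow_zero] at this
        exact Submodule.mem_sup_left this
      · exact Submodule.mem_sup_right (mem_degreeSpan b d h)
    obtain ⟨y, hy, z, hz, rfl⟩ := Submodule.mem_sup.mp (hsup (Submodule.mem_top (x := x)))
    obtain ⟨a, rfl⟩ := Submodule.mem_one.mp hy
    have hnil : IsNilpotent (algebraMap k R a) := by
      have := (Commute.all _ _).isNilpotent_sub (mem_nilradical.mp hx) (hle z hz)
      simpa using this
    have ha : a = 0 := by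
      rw [IsNilpotent.map_iff (algebraMap k R).injective] at hnil
      exact hnil.eq_zero
    simpa [ha] using hz
  · intro x hx
    exact mem_nilradical.mpr (hle x hx)

lemma finrank_degreeSpan [Fintype ι] (b : Basis ι k R) (d : ι → ℕ) (n : ℕ) :
    finrank k (degreeSpan k b d n) = (Finset.univ.filter fun i => n ≤ d i).card := by
  rw [degreeSpan, Set.image_eq_range]
  exact (finrank_span_eq_card (b.linearIndependent.comp (fun i : {i | n ≤ d i} => i.1)
    Subtype.val_injective)).trans (Fintype.card_subtype _)

lemma card_filter_eq [Fintype ι] [Fintype κ] [Nontrivial R] [Nontrivial S]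
    (hb : IsAdicBasis b d) (hc : IsAdicBasis c e) (f : R ≃ₐ[k] S) (n : ℕ) :
    (Finset.univ.filter fun i => n ≤ d i).card = (Finset.univ.filter fun j => n ≤ e j).card := by
  rcases Nat.eq_zero_or_pos n with rfl | hn
  · simpa [finrank_eq_card_basis b, finrank_eq_card_basis c] using f.toLinearEquiv.finrank_eq
  have hmap : (degreeSpan k b d 1).map f.toAlgHom.toLinearMap = degreeSpan k c e 1 := by
    rw [← hb.nilradical_eq, ← hc.nilradical_eq]
    ext y
    constructor
    · rintro ⟨x, hx, rfl⟩
      exact mem_nilradical.mpr ((mem_nilradical.mp hx).map f)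
    · intro hy
      exact ⟨f.symm y, mem_nilradical.mpr ((mem_nilradical.mp hy).map f.symm), by simp⟩
  have hpow : (degreeSpan k b d n).map f.toAlgHom.toLinearMap = degreeSpan k c e n := by
    rw [← hb.degreeSpan_one_pow hn.ne', ← hc.degreeSpan_one_pow hn.ne', ← hmap, Submodule.map_pow]
  rw [← finrank_degreeSpan b, ← finrank_degreeSpan c, ← hpow]
  exact (f.toLinearEquiv.finrank_map_eq _).symm

open Polynomial in
lemma sum_X_pow_eq [Fintype ι] [Fintype κ] [Nontrivial R] [Nontrivial S]
    (hb : IsAdicBasis b d) (hc : IsAdicBasis c e) (f : R ≃ₐ[k] S) :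
    ∑ i, (Polynomial.X : ℚ[X]) ^ d i = ∑ j, Polynomial.X ^ e j := by
  ext n
  simp only [finsetSum_coeff, Polynomial.coeff_X_pow, Finset.sum_boole]
  have h0 := hb.card_filter_eq hc f n
  rw [card_filter_le_eq d, card_filter_le_eq e, hb.card_filter_eq hc f (n + 1)] at h0
  exact_mod_cast Nat.add_right_cancel h0

open TensorProduct

lemma tensorProduct (hb : IsAdicBasis b d) (hc : IsAdicBasis c e) :
    IsAdicBasis (b.tensorProduct c) (fun x => d x.1 + e x.2) := by
  set F := degreeSpan k (b.tensorProduct c) (fun x => d x.1 + e x.2)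
  have htmul : ∀ p q x y, x ∈ degreeSpan k b d p → y ∈ degreeSpan k c e q →
      x ⊗ₜ[k] y ∈ F (p + q) := by
    intro p q x y hx hy
    have := Submodule.apply_mem_map₂ (TensorProduct.mk k R S) hx hy
    rw [degreeSpan, degreeSpan, Submodule.map₂_span_span] at this
    refine Submodule.span_le.mpr ?_ this
    rintro _ ⟨_, ⟨i, hi, rfl⟩, _, ⟨j, hj, rfl⟩, rfl⟩
    change b i ⊗ₜ[k] c j ∈ F (p + q)
    rw [ ← Basis.tensorProduct_apply]
    exact mem_degreeSpan _ _ (add_le_add hi hj)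
  refine ⟨?_, ?_⟩
  · rintro ⟨i, j⟩ ⟨i', j'⟩
    simp only [Basis.tensorProduct_apply, Algebra.TensorProduct.tmul_mul_tmul]
    rw [add_add_add_comm]
    exact htmul _ _ _ _ (hb.mul_mem i i') (hc.mul_mem j j')
  · rintro ⟨i, j⟩
    have h1 : (degreeSpan k b d 1).map
        (Algebra.TensorProduct.includeLeft : R →ₐ[k] R ⊗[k] S).toLinearMap ≤ F 1 := by
      rintro _ ⟨x, hx, rfl⟩
      exact htmul 1 0 x 1 hx (by simp [c.degreeSpan_zero])
    have h2 : (degreeSpan k c e 1).map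
        (Algebra.TensorProduct.includeRight : S →ₐ[k] R ⊗[k] S).toLinearMap ≤ F 1 := by
      rintro _ ⟨x, hx, rfl⟩
      simpa using htmul 0 1 1 x (by simp [b.degreeSpan_zero]) hx
    have h3 := Submodule.mul_mem_mul
      (pow_le_pow_left' h1 (d i) (by
        rw [← Submodule.map_pow]; exact Submodule.mem_map_of_mem (hb.mem_pow i)))
      (pow_le_pow_left' h2 (e j) (by
        rw [← Submodule.map_pow]; exact Submodule.mem_map_of_mem (hc.mem_pow j)))
    rw [← pow_add] at h3
    simpa [Basis.tensorProduct_apply] using h3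

end IsAdicBasis

end DegreeFiltration

section MonomialQuotient

variable {k σ : Type*} [Field k]

/-- The exponents not divisible by any exponent in `s`. -/
def standardExponents (s : Set (σ →₀ ℕ)) : Set (σ →₀ ℕ) :=
  {a | ∀ g ∈ s, ¬ g ≤ a}

/-- The ideal generated by the monomials with exponents in `s`. -/
noncomputable abbrev monomialIdeal (k : Type*) [Field k] (s : Set (σ →₀ ℕ)) : Ideal (MvPolynomial σ k) :=
  Ideal.span ((fun a => monomial a (1 : k)) '' s)

lemma mk_monomial_eq_zero {s : Set (σ →₀ ℕ)} {a : σ →₀ ℕ} (ha : a ∉ standardExponents s) :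
    Ideal.Quotient.mk (monomialIdeal k s) (monomial a 1) = 0 := by
  rw [Ideal.Quotient.eq_zero_iff_mem, mem_ideal_span_monomial_image]
  intro x hx
  obtain rfl : x = a := by simpa using support_monomial_subset hx
  simpa [standardExponents] using ha

/-- The standard monomials form a basis of the quotient by a monomial ideal. -/
noncomputable def standardBasis (k : Type*) [Field k] (s : Set (σ →₀ ℕ)) :
    Basis (standardExponents s) k (MvPolynomial σ k ⧸ monomialIdeal k s) :=
  Basis.mk (v := fun a => Ideal.Quotient.mkₐ k (monomialIdeal k s) (monomial a.1 1))
    (by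
      have h : LinearIndependent k fun a : standardExponents s => monomial a.1 (1 : k) := by
        have := (basisMonomials σ k).linearIndependent.comp
          (Subtype.val : standardExponents s → σ →₀ ℕ) Subtype.val_injective
        simpa [Function.comp_def] using this
      refine h.map (f := (Ideal.Quotient.mkₐ k (monomialIdeal k s)).toLinearMap) ?_
      rw [Submodule.disjoint_def]
      intro x hx hker
      have hmem : x ∈ restrictSupport k (standardExponents s) := by
        rw [restrictSupport_eq_span, Set.image_eq_range]
        exact hx
      rw [mem_restrictSupport_iff] at hmem
      have hI : x ∈ monomialIdeal k s := by
        rw [← Ideal.Quotient.eq_zero_iff_mem]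
        exact hker
      rw [mem_ideal_span_monomial_image] at hI
      rw [← MvPolynomial.support_eq_empty, Finset.eq_empty_iff_forall_notMem]
      intro a ha
      obtain ⟨g, hg, hga⟩ := hI a ha
      exact hmem ha g hg hga)
    (by
      rintro y -
      obtain ⟨p, rfl⟩ := Ideal.Quotient.mkₐ_surjective k (monomialIdeal k s) y
      induction p using MvPolynomial.induction_on' with
      | add p q hp hq => rw [map_add]; exact add_mem hp hq
      | monomial a r =>
        rw [show monomial a r = r • monomial a (1 : k) by simp [smul_monomial], map_smul]
        refine Submodule.smul_mem _ _ ?_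
        by_cases ha : a ∈ standardExponents s
        · exact Submodule.subset_span ⟨⟨a, ha⟩, rfl⟩
        · rw [Ideal.Quotient.mkₐ_eq_mk, mk_monomial_eq_zero ha]
          exact zero_mem _)

lemma standardBasis_apply (s : Set (σ →₀ ℕ)) (a : standardExponents s) :
    standardBasis k s a = Ideal.Quotient.mk (monomialIdeal k s) (monomial a.1 1) := by
  simp [standardBasis]

lemma isAdicBasis_standardBasis (s : Set (σ →₀ ℕ)) :
    IsAdicBasis (standardBasis k s) (fun a => a.1.degree) := by
  have hmem : ∀ a : σ →₀ ℕ, Ideal.Quotient.mk (monomialIdeal k s) (monomial a 1) ∈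
      degreeSpan k (standardBasis k s) (fun a => a.1.degree) a.degree := by
    intro a
    by_cases ha : a ∈ standardExponents s
    · rw [← standardBasis_apply s ⟨a, ha⟩]
      exact mem_degreeSpan _ _ le_rfl
    · rw [mk_monomial_eq_zero ha]
      exact zero_mem _
  refine ⟨fun a b => ?_, fun a => ?_⟩
  · rw [standardBasis_apply, standardBasis_apply, ← map_mul, monomial_mul, one_mul, ← map_add]
    exact hmem _
  · rw [standardBasis_apply]
    generalize a.1 = a
    induction a using Finsupp.induction_linear with
    | zero => exact Submodule.mem_one.mpr ⟨1, by simp⟩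
    | add a b ha hb =>
      rw [map_add, pow_add, ← one_mul (1 : k), ← monomial_mul, map_mul]
      exact Submodule.mul_mem_mul ha hb
    | single i n =>
      have h := Submodule.pow_mem_pow _ (hmem (Finsupp.single i 1)) n
      rw [← map_pow, monomial_pow, one_pow, Finsupp.degree_single, Finsupp.smul_single_one] at h
      rwa [Finsupp.degree_single]

lemma finite_standardExponents [Finite σ] {s : Set (σ →₀ ℕ)} (N : σ → ℕ)
    (h : ∀ i, Finsupp.single i (N i) ∈ s) : (standardExponents s).Finite := by
  refine Set.Finite.of_finite_image (f := ((↑) : (σ →₀ ℕ) → σ → ℕ))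
    ((Set.Finite.pi fun i => Set.finite_Iic (N i)).subset ?_) DFunLike.coe_injective.injOn
  rintro _ ⟨a, ha, rfl⟩ i -
  have := ha _ (h i)
  rw [Finsupp.single_le_iff] at this
  simpa using (not_le.mp this).le

lemma sum_standardExponents_powers {s : ℕ} (N : Fin s → ℕ)
    [Fintype (standardExponents (Set.range fun i => Finsupp.single i (N i)))] :
    ∑ a : standardExponents (Set.range fun i => Finsupp.single i (N i)),
        (Polynomial.X : Polynomial ℚ) ^ a.1.degree =
      ∏ i, ∑ j ∈ Finset.range (N i), Polynomial.X ^ j := by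
  have hstd : ∀ a : Fin s →₀ ℕ,
      a ∈ standardExponents (Set.range fun i => Finsupp.single i (N i)) ↔ ∀ i, a i < N i := by
    intro a
    simp [standardExponents, Finsupp.single_le_iff]
  rw [Finset.prod_univ_sum]
  refine Finset.sum_bij (fun a _ => a.1) ?_ ?_ ?_ ?_
  · intro a _
    simpa using (hstd a.1).mp a.2
  · intro a _ b _ h
    exact Subtype.ext (DFunLike.coe_injective h)
  · intro f hf
    refine ⟨⟨Finsupp.equivFunOnFinite.symm f, (hstd _).mpr (by simpa using hf)⟩, by simp, ?_⟩
    ext i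
    simp
  · intro a _
    rw [Finset.prod_pow_eq_pow_sum, Finsupp.degree_eq_sum]

lemma exists_isAdicBasis {s : Set (σ →₀ ℕ)} {I : Ideal (MvPolynomial σ k)}
    (hI : I = monomialIdeal k s) :
    ∃ b : Basis (standardExponents s) k (MvPolynomial σ k ⧸ I),
      IsAdicBasis b (fun a => a.1.degree) := by
  subst hI
  exact ⟨_, isAdicBasis_standardBasis s⟩

lemma zero_mem_standardExponents {s : Set (σ →₀ ℕ)} (h : 0 ∉ s) : 0 ∈ standardExponents s :=
  fun _ hg hle => h (le_antisymm hle zero_le ▸ hg)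

lemma exists_isAdicBasis_algA (k : Type*) [Field k] :
    ∃ (ι : Type) (_ : Fintype ι) (_ : Nonempty ι) (b : Basis ι k (algA k)) (d : ι → ℕ),
      IsAdicBasis b d := by
  let s : Set (Fin 3 →₀ ℕ) := {Finsupp.single 0 2, Finsupp.single 1 2, Finsupp.single 2 2,
    Finsupp.single 0 1 + Finsupp.single 1 1, Finsupp.single 0 1 + Finsupp.single 2 1,
    Finsupp.single 1 1 + Finsupp.single 2 1}
  have hfin : (standardExponents s).Finite :=
    finite_standardExponents (fun _ => 2) fun i => by fin_cases i <;> simp [s]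
  obtain ⟨b, hb⟩ := exists_isAdicBasis (k := k) (s := s) (I := Ideal.span
    {X 0 ^ 2, X 1 ^ 2, X 2 ^ 2, X 0 * X 1, X 0 * X 2, X 1 * X 2}) (by
      congr 1
      simp [s, Set.image_insert_eq, X, monomial_pow, monomial_mul])
  have h0 : (0 : Fin 3 →₀ ℕ) ∉ s := by
    intro h
    simp only [s, Set.mem_insert_iff, Set.mem_singleton_iff] at h
    rcases h with h | h | h | h | h | h <;> simpa using congrArg Finsupp.degree h
  exact ⟨_, hfin.fintype, ⟨⟨0, zero_mem_standardExponents h0⟩⟩, b, _, hb⟩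

lemma exists_isAdicBasis_algAm (k : Type*) [Field k] {s : ℕ} (m : Fin s → ℕ) :
    ∃ (ι : Type) (_ : Fintype ι) (_ : Nonempty ι) (b : Basis ι k (algAm k m)) (d : ι → ℕ),
      IsAdicBasis b d ∧ ∑ i, (Polynomial.X : Polynomial ℚ) ^ d i =
        ∏ i, ∑ j ∈ Finset.range (2 ^ m i), Polynomial.X ^ j := by
  let S : Set (Fin s →₀ ℕ) := Set.range fun i => Finsupp.single i (2 ^ m i)
  have hfin : (standardExponents S).Finite :=
    finite_standardExponents (fun i => 2 ^ m i) fun i => ⟨i, rfl⟩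
  let _ := hfin.fintype
  obtain ⟨b, hb⟩ := exists_isAdicBasis (k := k) (s := S)
    (I := Ideal.span (Set.range fun i => X i ^ 2 ^ m i)) (by
      rw [monomialIdeal, ← Set.range_comp]
      simp [Function.comp_def, X, monomial_pow])
  have h0 : (0 : Fin s →₀ ℕ) ∉ S := by
    rintro ⟨i, hi⟩
    simpa using congrArg Finsupp.degree hi
  exact ⟨_, inferInstance, ⟨⟨0, zero_mem_standardExponents h0⟩⟩, b, _, hb,
    sum_standardExponents_powers fun i => 2 ^ m i⟩

end MonomialQuotient

section GeometricSums

open Polynomial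

lemma emultiplicity_cyclotomic_cyclotomic {a : ℕ} (ha : 0 < a) (b : ℕ) :
    emultiplicity (cyclotomic a ℚ) (cyclotomic b ℚ) = if b = a then 1 else 0 := by
  have hirr := cyclotomic.irreducible_rat ha
  split_ifs with h
  · subst h
    exact (FiniteMultiplicity.of_not_isUnit hirr.not_isUnit hirr.ne_zero).emultiplicity_self
  · rw [emultiplicity_eq_zero]
    exact fun hdvd => hirr.not_isUnit
      ((cyclotomic.isCoprime_rat (Ne.symm h)).isUnit_of_dvd' dvd_rfl hdvd)

lemma emultiplicity_cyclotomic_geom_sum {j : ℕ} (hj : 1 ≤ j) (l : ℕ) :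
    emultiplicity (cyclotomic (2 ^ j) ℚ)
      (∑ i ∈ Finset.range (2 ^ l), (Polynomial.X : ℚ[X]) ^ i) = if j ≤ l then 1 else 0 := by
  have hpos : 0 < 2 ^ j := by positivity
  rw [← prod_cyclotomic_eq_geom_sum (by positivity),
    Finset.emultiplicity_prod (cyclotomic.irreducible_rat hpos).prime]
  simp only [emultiplicity_cyclotomic_cyclotomic hpos, Finset.sum_ite_eq']
  refine if_congr ?_ rfl rfl
  simp [Nat.pow_dvd_pow_iff_le_right, Nat.one_le_iff_ne_zero.mp hj]

lemma card_filter_le_of_prod_geom_sum_eq {s t : ℕ} {m : Fin s → ℕ} {n : Fin t → ℕ}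
    (h : ∏ i, ∑ j ∈ Finset.range (2 ^ m i), (Polynomial.X : ℚ[X]) ^ j =
      ∏ i, ∑ j ∈ Finset.range (2 ^ n i), Polynomial.X ^ j) {j : ℕ} (hj : 1 ≤ j) :
    (Finset.univ.filter fun i => j ≤ m i).card = (Finset.univ.filter fun i => j ≤ n i).card := by
  have hp := (cyclotomic.irreducible_rat (n := 2 ^ j) (by positivity)).prime
  have := congrArg (emultiplicity (cyclotomic (2 ^ j) ℚ)) h
  simp only [Finset.emultiplicity_prod hp, emultiplicity_cyclotomic_geom_sum hj,
    Finset.sum_boole] at this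
  exact_mod_cast this

lemma lt_card_filter_le_iff {s : ℕ} {m : Fin s → ℕ} (hm : Antitone m) (i : Fin s) (j : ℕ) :
    (i : ℕ) < (Finset.univ.filter fun i => j ≤ m i).card ↔ j ≤ m i := by
  constructor
  · intro h
    by_contra hj
    refine absurd h (not_lt.mpr ?_)
    rw [← Fin.card_Iio i]
    refine Finset.card_le_card fun i' hi' => ?_
    simp only [Finset.mem_filter, Finset.mem_univ, true_and] at hi'
    rw [Finset.mem_Iio]
    by_contra hle
    exact hj (hi'.trans (hm (not_lt.mp hle)))
  · intro hj
    rw [Nat.lt_iff_add_one_le, ← Fin.card_Iic i]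
    refine Finset.card_le_card fun i' hi' => ?_
    simpa using hj.trans (hm (Finset.mem_Iic.mp hi'))

end GeometricSums

theorem tensor_iso_implies_eq_tuple {k : Type*} [Field k] {s t : ℕ}
    (m : Fin s → ℕ) (n : Fin t → ℕ)
    (hm1 : ∀ i, 1 ≤ m i) (hn1 : ∀ i, 1 ≤ n i)
    (hm : Antitone m) (hn : Antitone n)
    (h : Nonempty (TensorProduct k (algAm k m) (algA k) ≃ₐ[k]
      TensorProduct k (algAm k n) (algA k))) :
    ∃ hst : s = t, ∀ i : Fin s, m i = n (Fin.cast hst i) := by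
  obtain ⟨f⟩ := h
  obtain ⟨ι, _, _, b, d, hb⟩ := exists_isAdicBasis_algA k
  obtain ⟨κ, _, _, c, e, hc, hsum⟩ := exists_isAdicBasis_algAm k m
  obtain ⟨κ', _, _, c', e', hc', hsum'⟩ := exists_isAdicBasis_algAm k n
  have := nontrivial_of_ne _ _ ((c.tensorProduct b).ne_zero (Classical.arbitrary _))
  have := nontrivial_of_ne _ _ ((c'.tensorProduct b).ne_zero (Classical.arbitrary _))
  have hX := (hc.tensorProduct hb).sum_X_pow_eq (hc'.tensorProduct hb) f
  simp only [pow_add, Fintype.sum_prod_type, ← Finset.mul_sum, ← Finset.sum_mul] at hX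
  have hne : ∑ i, (Polynomial.X : Polynomial ℚ) ^ d i ≠ 0 := by
    intro h0
    simpa [Polynomial.eval_finsetSum] using congrArg (Polynomial.eval 1) h0
  have hcard := fun j => card_filter_le_of_prod_geom_sum_eq (j := j)
    (hsum ▸ hsum' ▸ mul_right_cancel₀ hne hX)
  have hst : s = t := by simpa [hm1, hn1] using hcard 1 le_rfl
  subst hst
  refine ⟨rfl, fun i => ?_⟩
  have hiff : ∀ j, 1 ≤ j → (j ≤ m i ↔ j ≤ n i) := fun j hj => by
    rw [← lt_card_filter_le_iff hm, ← lt_card_filter_le_iff hn, hcard j hj]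
  exact le_antisymm ((hiff _ (hm1 i)).mp le_rfl) ((hiff _ (hn1 i)).mpr le_rfl)
end

section
/- Let $k$ be an algebraically closed field of characteristic $2$ and let $A_4$ denote the alternating group on $4$ letters. Then the centre $Z(kA_4)$ of the group algebra $kA_4$ is isomorphic as a $k$-algebra to $A = k[X,Y,Z]/(X^2,Y^2,Z^2,XY,XZ,YZ)$. -/
open MvPolynomial

namespace MonoidAlgebra

variable {k G : Type*} [Field k] [Group G] [DecidableEq G]

/-- The sum in `k[G]` of the elements of a finite subset of `G`. -/
noncomputable def finsetSum (k : Type*) {G : Type*} [Field k] (s : Finset G) : MonoidAlgebra k G :=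
  ∑ g ∈ s, single g 1

omit [Group G] in
lemma coeff_finsetSum (s : Finset G) (h : G) :
    (finsetSum k s).coeff h = if h ∈ s then 1 else 0 := by
  simp [finsetSum, coeff_sum, Finsupp.finsetSum_apply, Finsupp.single_apply]

lemma single_mul_finsetSum (s : Finset G) (g : G) :
    single g 1 * finsetSum k s = finsetSum k (s.image (g * ·)) := by
  rw [finsetSum, finsetSum, Finset.sum_image (mul_right_injective g).injOn, Finset.mul_sum]
  simp [single_mul_single]

lemma finsetSum_mul_finsetSum {s t u : Finset G} (h : ∀ g ∈ s, t.image (g * ·) = u) :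
    finsetSum k s * finsetSum k t = (s.card : k) • finsetSum k u := by
  rw [finsetSum, Finset.sum_mul, Finset.sum_congr rfl fun g hg => by
    rw [single_mul_finsetSum, h g hg], Finset.sum_const, Nat.cast_smul_eq_nsmul]

omit [DecidableEq G] in
lemma mem_center_iff_coeff_conj {x : MonoidAlgebra k G} :
    x ∈ Subalgebra.center k (MonoidAlgebra k G) ↔
      ∀ g h : G, x.coeff (g * h * g⁻¹) = x.coeff h := by
  rw [Subalgebra.mem_center_iff]
  constructor
  · intro hx g h
    have := congrArg (fun y => y.coeff (g * h)) (hx (single g 1))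
    simpa [coeff_single_mul_apply, coeff_mul_single_apply] using this.symm
  · intro hx b
    induction b using MonoidAlgebra.induction_linear with
    | zero => simp
    | add f g hf hg => rw [add_mul, mul_add, hf, hg]
    | single g r =>
      ext h
      rw [coeff_single_mul_apply, coeff_mul_single_apply, ← hx g (g⁻¹ * h), mul_comm]
      simp

lemma finsetSum_mem_center {s : Finset G} (hs : ∀ g h : G, g * h * g⁻¹ ∈ s ↔ h ∈ s) :
    finsetSum k s ∈ Subalgebra.center k (MonoidAlgebra k G) :=
  mem_center_iff_coeff_conj.2 fun g h => by simp only [coeff_finsetSum, hs]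

end MonoidAlgebra

namespace alternatingGroupFour

open MonoidAlgebra

/-- A three-cycle in `A₄`. -/
def threeCycle : alternatingGroup (Fin 4) := ⟨Equiv.swap 0 1 * Equiv.swap 1 2,
  Equiv.Perm.mem_alternatingGroup.2 (by decide)⟩

/-- A double transposition in `A₄`. -/
def doubleSwap : alternatingGroup (Fin 4) := ⟨Equiv.swap 0 1 * Equiv.swap 2 3,
  Equiv.Perm.mem_alternatingGroup.2 (by decide)⟩

/-- The cosets of the Klein four-group in `A₄`. -/
def coset (i : Fin 3) : Finset (alternatingGroup (Fin 4)) :=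
  Finset.univ.filter fun g => (threeCycle ^ (i : ℕ) * g) ^ 2 = 1

lemma card_coset : ∀ i, (coset i).card = 4 := by decide +kernel

lemma exists_image_mul_coset :
    ∀ i j, ∃ l, ∀ g ∈ coset i, (coset j).image (g * ·) = coset l := by decide +kernel

lemma conj_mem_coset : ∀ i, ∀ g h, g * h * g⁻¹ ∈ coset i ↔ h ∈ coset i := by decide +kernel

/-- Representatives of the conjugacy classes of nontrivial elements. -/
def classRep (i : Fin 3) : alternatingGroup (Fin 4) :=
  if i = 0 then doubleSwap else (threeCycle ^ (i : ℕ))⁻¹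

lemma classRep_ne_one : ∀ i, classRep i ≠ 1 := by decide +kernel

lemma classRep_mem_coset : ∀ i j, classRep i ∈ coset j ↔ i = j := by decide +kernel

lemma one_mem_coset : ∀ j, 1 ∈ coset j ↔ j = 0 := by decide +kernel

lemma eq_one_or_exists_conj :
    ∀ h : alternatingGroup (Fin 4), h = 1 ∨ ∃ i g, h = g * classRep i * g⁻¹ := by decide +kernel

variable (k : Type*) [Field k]

/-- The coset sums as central elements of the group algebra. -/
noncomputable def cosetSum (i : Fin 3) :
    Subalgebra.center k (MonoidAlgebra k (alternatingGroup (Fin 4))) :=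
  ⟨finsetSum k (coset i), finsetSum_mem_center (conj_mem_coset i)⟩

lemma cosetSum_mul_cosetSum [CharP k 2] (i j : Fin 3) : cosetSum k i * cosetSum k j = 0 := by
  obtain ⟨l, hl⟩ := exists_image_mul_coset i j
  have h4 : ((4 : ℕ) : k) = 0 := (CharP.cast_eq_zero_iff k 2 4).2 (by norm_num)
  ext1
  change finsetSum k (coset i) * finsetSum k (coset j) = 0
  rw [finsetSum_mul_finsetSum hl, card_coset, h4, zero_smul]

lemma coeff_combination_one (a : k) (b : Fin 3 → k) :
    (algebraMap k (Subalgebra.center k (MonoidAlgebra k (alternatingGroup (Fin 4)))) a +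
      ∑ i, b i • cosetSum k i).1.coeff 1 = a + b 0 := by
  simp [cosetSum, MonoidAlgebra.coeff_sum, coeff_finsetSum, one_mem_coset]

lemma coeff_combination_classRep (a : k) (b : Fin 3 → k) (i : Fin 3) :
    (algebraMap k (Subalgebra.center k (MonoidAlgebra k (alternatingGroup (Fin 4)))) a +
      ∑ i, b i • cosetSum k i).1.coeff (classRep i) = b i := by
  simp [cosetSum, MonoidAlgebra.coeff_sum, coeff_finsetSum, classRep_mem_coset,
    (classRep_ne_one i).symm]

lemma eq_combination (x : Subalgebra.center k (MonoidAlgebra k (alternatingGroup (Fin 4)))) :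
    ∃ (a : k) (b : Fin 3 → k), x = algebraMap k _ a + ∑ i, b i • cosetSum k i := by
  refine ⟨x.1.coeff 1 - x.1.coeff (classRep 0), fun i => x.1.coeff (classRep i), ?_⟩
  ext h
  obtain rfl | ⟨i, g, rfl⟩ := eq_one_or_exists_conj h
  · rw [coeff_combination_one, sub_add_cancel]
  · rw [mem_center_iff_coeff_conj.1 x.2, mem_center_iff_coeff_conj.1 (Subtype.prop _),
      coeff_combination_classRep]

end alternatingGroupFour

namespace algA

/-- The ideal `(X², Y², Z², XY, XZ, YZ)`. -/
noncomputable abbrev relations (k : Type*) [Field k] : Ideal (MvPolynomial (Fin 3) k) :=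
  Ideal.span {X 0 ^ 2, X 1 ^ 2, X 2 ^ 2, X 0 * X 1, X 0 * X 2, X 1 * X 2}

variable {k : Type*} [Field k]

lemma X_mul_X_mem_relations (i j : Fin 3) : (X i * X j : MvPolynomial (Fin 3) k) ∈ relations k := by
  wlog h : i ≤ j
  · rw [mul_comm]
    exact this j i (le_of_not_ge h)
  apply Ideal.subset_span
  fin_cases i <;> fin_cases j <;> simp [pow_two] at h ⊢

lemma mk_eq_combination (p : MvPolynomial (Fin 3) k) : ∃ (a : k) (b : Fin 3 → k),
    Ideal.Quotient.mk (relations k) p =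
      Ideal.Quotient.mk (relations k) (C a + ∑ i, b i • X i) := by
  induction p using MvPolynomial.induction_on with
  | C a => exact ⟨a, 0, by simp⟩
  | add p q hp hq =>
    obtain ⟨a, b, h⟩ := hp
    obtain ⟨a', b', h'⟩ := hq
    refine ⟨a + a', b + b', ?_⟩
    rw [map_add, h, h', ← map_add]
    congr 1
    simp only [Pi.add_apply, add_smul, Finset.sum_add_distrib, C_add]
    ring
  | mul_X p j hp =>
    obtain ⟨a, b, h⟩ := hp
    refine ⟨0, Pi.single j a, ?_⟩
    rw [map_mul, h, ← map_mul, Ideal.Quotient.eq]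
    have : (C a + ∑ i, b i • X i) * X j - (C 0 + ∑ i, (Pi.single j a : Fin 3 → k) i • X i) =
        ∑ i, C (b i) * (X i * X j) := by
      simp [Pi.single_apply, add_mul, Finset.sum_mul, smul_eq_C_mul, mul_assoc]
    rw [this]
    exact Ideal.sum_mem _ fun i _ => Ideal.mul_mem_left _ _ (X_mul_X_mem_relations i j)

end algA

open alternatingGroupFour

theorem center_groupAlgebra_A4_iso
    {k : Type*} [Field k] [IsAlgClosed k] [CharP k 2] :
    Nonempty
      (Subalgebra.center k (MonoidAlgebra k (alternatingGroup (Fin 4))) ≃ₐ[k] algA k) := by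
  have hker : ∀ p ∈ algA.relations k, aeval (cosetSum k) p = 0 := by
    intro p hp
    refine (Ideal.span_le (I := RingHom.ker (aeval (R := k) (cosetSum k)))).2 ?_ hp
    rintro _ (rfl | rfl | rfl | rfl | rfl | rfl) <;>
      simp [RingHom.mem_ker, pow_two, cosetSum_mul_cosetSum]
  have happly (a : k) (b : Fin 3 → k) :
      aeval (cosetSum k) (C a + ∑ i, b i • X i : MvPolynomial (Fin 3) k) =
        algebraMap k _ a + ∑ i, b i • cosetSum k i := by
    simp
  refine ⟨(AlgEquiv.ofBijective (Ideal.Quotient.liftₐ (algA.relations k)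
    (aeval (cosetSum k)) hker) ⟨?_, ?_⟩).symm⟩
  · rw [injective_iff_map_eq_zero]
    intro q hq
    obtain ⟨p, rfl⟩ := Ideal.Quotient.mk_surjective q
    obtain ⟨a, b, h⟩ := algA.mk_eq_combination p
    rw [h] at hq ⊢
    replace hq := (happly a b).symm.trans hq
    have hb : b = 0 := funext fun i => by
      simpa [hq] using (coeff_combination_classRep k a b i).symm
    have ha : a = 0 := by
      have h1 := coeff_combination_one k a b
      rw [hq, hb] at h1
      simpa using h1.symm
    simp [ha, hb]
  · intro x
    obtain ⟨a, b, rfl⟩ := eq_combination k x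
    exact ⟨Ideal.Quotient.mk _ (C a + ∑ i, b i • X i), happly a b⟩
end

section
/- Let $k$ be an algebraically closed field of characteristic $2$, let $A_4$ denote the alternating group on $4$ letters, and let $P$ be a finite abelian $2$-group with $P \cong C_{2^{m_1}} \times \dots \times C_{2^{m_s}}$, where each $m_i \geq 1$. Then the centre $Z(k(P \times A_4))$ of the group algebra $k(P \times A_4)$ is isomorphic as a $k$-algebra to $k[X_1,\dots,X_s,X,Y,Z]/(X_1^{2^{m_1}},\dots,X_s^{2^{m_s}},X^2,Y^2,Z^2,XY,XZ,YZ)$ (that is, to $A_{(m_1,\dots,m_s)} \otimes_k A$). -/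
open MvPolynomial

/-- `B = k[X₁,…,X_s,X,Y,Z]/(X₁^{2^{m₁}},…,X_s^{2^{m_s}},X²,Y²,Z²,XY,XZ,YZ)`,
which is isomorphic to `A_{(m₁,…,m_s)} ⊗_k A`. -/
abbrev algB (k : Type*) [Field k] {s : ℕ} (m : Fin s → ℕ) : Type _ :=
  MvPolynomial (Fin s ⊕ Fin 3) k ⧸
    Ideal.span
      ((Set.range fun i : Fin s => (X (Sum.inl i) : MvPolynomial (Fin s ⊕ Fin 3) k) ^ 2 ^ m i) ∪
        {X (Sum.inr 0) ^ 2, X (Sum.inr 1) ^ 2, X (Sum.inr 2) ^ 2,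
         X (Sum.inr 0) * X (Sum.inr 1), X (Sum.inr 0) * X (Sum.inr 2),
         X (Sum.inr 1) * X (Sum.inr 2)})

/-- An element `x` of `A₄` permutes the three pairings of `{0, 1, 2, 3}` cyclically, by a shift of
`altFourShift x`; this realises the quotient map `A₄ → C₃`. -/
def altFourShift (x : alternatingGroup (Fin 4)) : Fin 3 :=
  Fin.ofNat 3 ((((x : Equiv.Perm (Fin 4)) 0).val ^^^ ((x : Equiv.Perm (Fin 4)) 1).val) + 2)

lemma altFourShift_mul (x y : alternatingGroup (Fin 4)) :
    altFourShift (x * y) = altFourShift x + altFourShift y := by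
  revert x y; decide +kernel

lemma altFourShift_one : altFourShift 1 = 0 := by decide +kernel

lemma altFourShift_inv (x : alternatingGroup (Fin 4)) : altFourShift x⁻¹ = -altFourShift x := by
  revert x; decide +kernel

lemma card_altFourShift_fiber (j : Fin 3) :
    (Finset.univ.filter fun x => altFourShift x = j).card = 4 := by
  revert j; decide +kernel

lemma exists_conj_eq_of_altFourShift_eq {x y : alternatingGroup (Fin 4)} (hx : x ≠ 1) (hy : y ≠ 1)
    (h : altFourShift x = altFourShift y) : ∃ g, g * x * g⁻¹ = y := by
  revert x y; decide +kernel

lemma exists_ne_one_altFourShift_eq (j : Fin 3) : ∃ x ≠ 1, altFourShift x = j := by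
  revert j; decide +kernel

lemma MonoidAlgebra.mem_center_iff_coeff {k G : Type*} [CommSemiring k] [Group G]
    {f : MonoidAlgebra k G} :
    f ∈ Subalgebra.center k (MonoidAlgebra k G) ↔ ∀ g h, f.coeff (g * h) = f.coeff (h * g) := by
  rw [Subalgebra.mem_center_iff]
  constructor
  · intro hf g h
    have := congrArg (fun a => a.coeff h) (hf (single g⁻¹ 1))
    simpa using this
  · intro hf b
    induction b using MonoidAlgebra.induction_linear with
    | zero => simp
    | add x y hx hy => rw [add_mul, mul_add, hx, hy]
    | single g r =>
      ext h
      simp [mul_comm r, hf g⁻¹ h]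

section CosetSum

variable {k P : Type*} [Field k] [CommGroup P]

/-- The sum in `k(P × A₄)` of the coset of the Klein four-group on which `altFourShift` is `j`. -/
noncomputable def cosetSum (k P : Type*) [Field k] [CommGroup P] (j : Fin 3) :
    MonoidAlgebra k (P × alternatingGroup (Fin 4)) :=
  ∑ x with altFourShift x = j, MonoidAlgebra.single ((1 : P), x) 1

open Classical in
lemma coeff_cosetSum (j : Fin 3) (q : P × alternatingGroup (Fin 4)) :
    (cosetSum k P j).coeff q = if q.1 = 1 ∧ altFourShift q.2 = j then 1 else 0 := by
  obtain ⟨p, x⟩ := q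
  rw [cosetSum, MonoidAlgebra.coeff_sum, Finsupp.finsetSum_apply]
  by_cases hp : p = 1
  · subst hp
    simp [Finsupp.single_apply]
  · simp [hp]

lemma cosetSum_mem_center (j : Fin 3) :
    cosetSum k P j ∈ Subalgebra.center k (MonoidAlgebra k (P × alternatingGroup (Fin 4))) := by
  classical
  rw [MonoidAlgebra.mem_center_iff_coeff]
  intro g h
  simp only [coeff_cosetSum, Prod.fst_mul, Prod.snd_mul, altFourShift_mul, mul_comm g.1,
    add_comm (altFourShift g.2)]

lemma single_mul_cosetSum (x : alternatingGroup (Fin 4)) (j : Fin 3) :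
    MonoidAlgebra.single ((1 : P), x) (1 : k) * cosetSum k P j =
      cosetSum k P (altFourShift x + j) := by
  classical
  ext q
  simp [coeff_cosetSum, altFourShift_mul, altFourShift_inv, neg_add_eq_iff_eq_add]

lemma cosetSum_mul_cosetSum [CharP k 2] (i j : Fin 3) : cosetSum k P i * cosetSum k P j = 0 := by
  have h4 : (4 : MonoidAlgebra k (P × alternatingGroup (Fin 4))) = 0 := by
    have h2 : (2 : k) = 0 := CharTwo.two_eq_zero
    have : (4 : k) = 0 := by linear_combination 2 * h2
    rw [← map_ofNat (algebraMap k (MonoidAlgebra k _)) 4, this, map_zero]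
  conv_lhs => enter [1]; rw [cosetSum]
  rw [Finset.sum_mul, Finset.sum_congr rfl (g := fun _ => cosetSum k P (i + j))]
  · simp [card_altFourShift_fiber, h4]
  · intro x hx
    rw [single_mul_cosetSum, (Finset.mem_filter.mp hx).2]

/-- The inclusion of `kP` into the centre of `k(P × A₄)`. -/
noncomputable def inclCenter (k P : Type*) [Field k] [CommGroup P] : MonoidAlgebra k P →ₐ[k]
    Subalgebra.center k (MonoidAlgebra k (P × alternatingGroup (Fin 4))) :=
  (MonoidAlgebra.mapDomainAlgHom k k (MonoidHom.inl P (alternatingGroup (Fin 4)))).codRestrict _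
    fun a => by
      classical
      induction a using MonoidAlgebra.induction_linear with
      | zero => simp
      | add x y hx hy => rw [map_add]; exact add_mem hx hy
      | single p r =>
        rw [MonoidAlgebra.mem_center_iff_coeff]
        intro g h
        have : ((p, 1) : P × alternatingGroup (Fin 4)) = g * h ↔ (p, 1) = h * g := by
          rw [Prod.ext_iff, Prod.ext_iff, Prod.fst_mul, Prod.fst_mul, mul_comm g.1]
          exact and_congr_right fun _ => eq_comm.trans (mul_eq_one_comm.trans eq_comm)
        simp [Finsupp.single_apply, this]

lemma coe_inclCenter_single (p : P) (r : k) :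
    (inclCenter k P (MonoidAlgebra.single p r) :
      MonoidAlgebra k (P × alternatingGroup (Fin 4))) = MonoidAlgebra.single (p, 1) r := by
  simp [inclCenter]

open Classical in
lemma coeff_inclCenter (a : MonoidAlgebra k P) (q : P × alternatingGroup (Fin 4)) :
    (inclCenter k P a : MonoidAlgebra k (P × alternatingGroup (Fin 4))).coeff q =
      if q.2 = 1 then a.coeff q.1 else 0 := by
  obtain ⟨p, x⟩ := q
  induction a using MonoidAlgebra.induction_linear with
  | zero => simp
  | add a b ha hb => by_cases hx : x = 1 <;> simp_all
  | single p' r =>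
    by_cases hx : x = 1 <;>
      simp [coe_inclCenter_single, Finsupp.single_apply, hx, eq_comm]

lemma coeff_inclCenter_mul_cosetSum (a : MonoidAlgebra k P) (j : Fin 3)
    (q : P × alternatingGroup (Fin 4)) :
    ((inclCenter k P a : MonoidAlgebra k (P × alternatingGroup (Fin 4))) *
      cosetSum k P j).coeff q = if altFourShift q.2 = j then a.coeff q.1 else 0 := by
  classical
  obtain ⟨p, x⟩ := q
  induction a using MonoidAlgebra.induction_linear with
  | zero => simp
  | add a b ha hb => by_cases hx : altFourShift x = j <;> simp_all [add_mul]
  | single p' r =>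
    by_cases hx : altFourShift x = j <;>
      simp [coe_inclCenter_single, coeff_cosetSum, Finsupp.single_apply, hx, inv_mul_eq_one]

/-- The `kP`-linear combination of `1` and the three coset sums with given coefficients. -/
noncomputable def centerCombination (k P : Type*) [Field k] [CommGroup P] :
    MonoidAlgebra k P × (Fin 3 → MonoidAlgebra k P) →
      Subalgebra.center k (MonoidAlgebra k (P × alternatingGroup (Fin 4))) :=
  fun a => inclCenter k P a.1 +
    ∑ j, inclCenter k P (a.2 j) * ⟨cosetSum k P j, cosetSum_mem_center j⟩

open Classical in
lemma coeff_centerCombination (a : MonoidAlgebra k P × (Fin 3 → MonoidAlgebra k P))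
    (q : P × alternatingGroup (Fin 4)) :
    (centerCombination k P a : MonoidAlgebra k (P × alternatingGroup (Fin 4))).coeff q =
      (if q.2 = 1 then a.1.coeff q.1 else 0) + (a.2 (altFourShift q.2)).coeff q.1 := by
  simp [centerCombination, coeff_inclCenter, coeff_inclCenter_mul_cosetSum]

lemma centerCombination_injective : Function.Injective (centerCombination k P) := by
  classical
  intro a b hab
  have h q := congrArg (fun c : Subalgebra.center k
    (MonoidAlgebra k (P × alternatingGroup (Fin 4))) => c.1.coeff q) hab
  simp only [coeff_centerCombination] at h
  have h2 : a.2 = b.2 := by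
    ext j p
    obtain ⟨x, hx, rfl⟩ := exists_ne_one_altFourShift_eq j
    simpa [hx] using h (p, x)
  refine Prod.ext ?_ h2
  ext p
  simpa [h2] using h (p, 1)

lemma centerCombination_surjective [Finite P] : Function.Surjective (centerCombination k P) := by
  classical
  intro f
  choose r hr hrj using exists_ne_one_altFourShift_eq
  refine ⟨(.ofCoeff (Finsupp.equivFunOnFinite.symm fun p =>
      f.1.coeff (p, 1) - f.1.coeff (p, r 0)),
    fun j => .ofCoeff (Finsupp.equivFunOnFinite.symm fun p => f.1.coeff (p, r j))), ?_⟩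
  ext ⟨p, x⟩
  rw [coeff_centerCombination]
  by_cases hx : x = 1
  · subst hx
    simp [altFourShift_one]
  · obtain ⟨g, hg⟩ := exists_conj_eq_of_altFourShift_eq (hr (altFourShift x)) hx (hrj _)
    have := MonoidAlgebra.mem_center_iff_coeff.mp f.2 (p, g * r (altFourShift x)) (1, g⁻¹)
    simpa [hx, hg] using this.symm

end CosetSum

/-- The homomorphism from a product of cyclic groups of orders `n i` sending the `i`-th standard
generator to `u i`. -/
def cyclicProdHom {ι M : Type*} [Fintype ι] [CommMonoid M] {n : ι → ℕ} [∀ i, NeZero (n i)]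
    (u : ι → M) (hu : ∀ i, u i ^ n i = 1) : (∀ i, Multiplicative (ZMod (n i))) →* M where
  toFun x := ∏ i, u i ^ (x i).toAdd.val
  map_one' := by simp
  map_mul' x y := by
    simp [ZMod.val_add, ← pow_eq_pow_mod _ (hu _), pow_add, Finset.prod_mul_distrib]

lemma cyclicProdHom_mulSingle {ι M : Type*} [Fintype ι] [DecidableEq ι] [CommMonoid M] {n : ι → ℕ}
    [∀ i, NeZero (n i)] (u : ι → M) (hu : ∀ i, u i ^ n i = 1) (i : ι) (hi : n i ≠ 1) :
    cyclicProdHom u hu (Pi.mulSingle i (.ofAdd 1)) = u i := by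
  simp only [cyclicProdHom, MonoidHom.coe_mk, OneHom.coe_mk]
  rw [Finset.prod_eq_single i]
  · simp [ZMod.val_one'' hi]
  · intro j _ hj
    simp [Pi.mulSingle_eq_of_ne hj]
  · simp

lemma map_cyclicProdHom {ι M N : Type*} [Fintype ι] [DecidableEq ι] [CommMonoid M] [CommMonoid N]
    {n : ι → ℕ} [∀ i, NeZero (n i)] (u : ι → M) (hu : ∀ i, u i ^ n i = 1) (F : M →* N)
    (G : (∀ i, Multiplicative (ZMod (n i))) →* N)
    (h : ∀ i, F (u i) = G (Pi.mulSingle i (.ofAdd 1))) (x : ∀ i, Multiplicative (ZMod (n i))) :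
    F (cyclicProdHom u hu x) = G x := by
  simp only [cyclicProdHom, MonoidHom.coe_mk, OneHom.coe_mk, map_prod, map_pow, h]
  conv_rhs => rw [← Finset.univ_prod_mulSingle x, map_prod]
  refine Finset.prod_congr rfl fun i _ => ?_
  rw [← map_pow, ← Pi.mulSingle_pow, ← ofAdd_nsmul]
  simp

lemma one_add_pow_two_pow (k : Type*) {R : Type*} [Field k] [CharP k 2] [CommRing R] [Algebra k R]
    (x : R) (n : ℕ) : (1 + x) ^ 2 ^ n = 1 + x ^ 2 ^ n := by
  rcases subsingleton_or_nontrivial R with _ | _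
  · exact Subsingleton.elim _ _
  · have : CharP R 2 := charP_of_injective_algebraMap (algebraMap k R).injective 2
    rw [add_pow_char_pow, one_pow]

section AlgB

variable {k : Type*} [Field k] {s : ℕ} {m : Fin s → ℕ}

/-- The class of the variable `X v` in `algB k m`. -/
noncomputable def algBVar (k : Type*) [Field k] {s : ℕ} (m : Fin s → ℕ) (v : Fin s ⊕ Fin 3) :
    algB k m :=
  Ideal.Quotient.mk _ (X v)

lemma algBVar_inl_pow (i : Fin s) : algBVar k m (.inl i) ^ 2 ^ m i = 0 := by
  rw [algBVar, ← map_pow, Ideal.Quotient.eq_zero_iff_mem]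
  exact Ideal.subset_span (.inl ⟨i, rfl⟩)

lemma algBVar_inr_mul_inr (i j : Fin 3) : algBVar k m (.inr i) * algBVar k m (.inr j) = 0 := by
  wlog hij : i ≤ j generalizing i j
  · rw [mul_comm]
    exact this j i (le_of_not_ge hij)
  rw [algBVar, algBVar, ← map_mul, Ideal.Quotient.eq_zero_iff_mem]
  refine Ideal.subset_span (.inr ?_)
  fin_cases i <;> fin_cases j <;> simp [pow_two] at hij ⊢

/-- The homomorphism out of `algB k m` determined by the images of the variables. -/
noncomputable def algBLift {R : Type*} [CommRing R] [Algebra k R] (f : Fin s ⊕ Fin 3 → R)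
    (hl : ∀ i, f (.inl i) ^ 2 ^ m i = 0) (hr : ∀ i j, f (.inr i) * f (.inr j) = 0) :
    algB k m →ₐ[k] R :=
  Ideal.Quotient.liftₐ _ (aeval f) fun a ha => by
    rw [← RingHom.mem_ker]
    refine (Ideal.span_le.mpr ?_) ha
    rintro _ (⟨i, rfl⟩ | h)
    · simp [RingHom.mem_ker, hl]
    · simp only [Set.mem_insert_iff, Set.mem_singleton_iff] at h
      rcases h with rfl | rfl | rfl | rfl | rfl | rfl <;> simp [RingHom.mem_ker, pow_two, hr]

lemma algBLift_algBVar {R : Type*} [CommRing R] [Algebra k R] (f : Fin s ⊕ Fin 3 → R)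
    (hl : ∀ i, f (.inl i) ^ 2 ^ m i = 0) (hr : ∀ i j, f (.inr i) * f (.inr j) = 0)
    (v : Fin s ⊕ Fin 3) : algBLift f hl hr (algBVar k m v) = f v :=
  aeval_X f v

lemma algB_induction {motive : algB k m → Prop} (algebraMap : ∀ r, motive (algebraMap k _ r))
    (add : ∀ a b, motive a → motive b → motive (a + b))
    (mul_var : ∀ a v, motive a → motive (a * algBVar k m v)) (a : algB k m) : motive a := by
  obtain ⟨p, rfl⟩ := Ideal.Quotient.mk_surjective a
  induction p using MvPolynomial.induction_on with
  | C r => exact algebraMap r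
  | add p q hp hq => rw [map_add]; exact add _ _ hp hq
  | mul_X p v hp => rw [map_mul]; exact mul_var _ v hp

lemma one_add_algBVar_pow [CharP k 2] (i : Fin s) : (1 + algBVar k m (.inl i)) ^ 2 ^ m i = 1 := by
  rw [one_add_pow_two_pow k, algBVar_inl_pow, add_zero]

variable {P : Type*} [CommGroup P]

/-- The homomorphism `kP → algB k m` sending the `i`-th generator of `P` to `1 + X_i`. -/
noncomputable def groupAlgebraToAlgB [CharP k 2]
    (e : P ≃* ∀ i : Fin s, Multiplicative (ZMod (2 ^ m i))) : MonoidAlgebra k P →ₐ[k] algB k m :=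
  MonoidAlgebra.lift k _ P ((cyclicProdHom (fun i => 1 + algBVar k m (.inl i))
    one_add_algBVar_pow).comp e.toMonoidHom)

/-- The combination of `1` and the last three variables of `algB k m` with coefficients in `kP`. -/
noncomputable def algBCombination [CharP k 2]
    (e : P ≃* ∀ i : Fin s, Multiplicative (ZMod (2 ^ m i)))
    (a : MonoidAlgebra k P × (Fin 3 → MonoidAlgebra k P)) : algB k m :=
  groupAlgebraToAlgB e a.1 + ∑ j, groupAlgebraToAlgB e (a.2 j) * algBVar k m (.inr j)

lemma algBCombination_surjective [CharP k 2] (hm : ∀ i, 1 ≤ m i)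
    (e : P ≃* ∀ i : Fin s, Multiplicative (ZMod (2 ^ m i))) :
    Function.Surjective (algBCombination (k := k) e) := by
  intro b
  induction b using algB_induction with
  | algebraMap r =>
    exact ⟨(algebraMap k _ r, 0), by simp only [algBCombination, AlgHom.commutes]; simp⟩
  | add a b ha hb =>
    obtain ⟨x, rfl⟩ := ha
    obtain ⟨y, rfl⟩ := hb
    exact ⟨x + y, by simp [algBCombination, add_mul, Finset.sum_add_distrib]; ring⟩
  | mul_var a v ha =>
    obtain ⟨x, rfl⟩ := ha
    rcases v with i | j
    · have hg : groupAlgebraToAlgB (k := k) e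
          (MonoidAlgebra.single (e.symm (Pi.mulSingle i (.ofAdd 1))) 1 - 1) =
            algBVar k m (.inl i) := by
        rw [map_sub, map_one (groupAlgebraToAlgB e), groupAlgebraToAlgB, MonoidAlgebra.lift_single]
        simp only [MonoidHom.comp_apply, MulEquiv.toMonoidHom_eq_coe, MonoidHom.coe_coe,
          MulEquiv.apply_symm_apply, one_smul]
        rw [cyclicProdHom_mulSingle _ _ i
          (Nat.one_lt_two_pow (Nat.one_le_iff_ne_zero.mp (hm i))).ne', add_sub_cancel_left]
      refine ⟨(x.1 * (MonoidAlgebra.single (e.symm (Pi.mulSingle i (.ofAdd 1))) 1 - 1), fun j =>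
        x.2 j * (MonoidAlgebra.single (e.symm (Pi.mulSingle i (.ofAdd 1))) 1 - 1)), ?_⟩
      simp only [algBCombination, map_mul, hg, add_mul, Finset.sum_mul,
        mul_right_comm _ (algBVar k m (.inl i)) (algBVar k m (.inr _))]
    · refine ⟨(0, Pi.single j x.1), ?_⟩
      simp only [algBCombination, map_zero, zero_add, add_mul, Finset.sum_mul, mul_assoc,
        algBVar_inr_mul_inr, mul_zero, Finset.sum_const_zero, add_zero]
      rw [Finset.sum_eq_single j]
      · simp
      · intro l _ hl
        simp [hl]
      · simp

/-- The homomorphism from `algB k m` to the centre of `k(P × A₄)` sending `X_i` to `g_i - 1`, for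
`g_i` the `i`-th generator of `P`, and the last three variables to the coset sums. -/
noncomputable def algBToCenter [CharP k 2]
    (e : P ≃* ∀ i : Fin s, Multiplicative (ZMod (2 ^ m i))) :
    algB k m →ₐ[k] Subalgebra.center k (MonoidAlgebra k (P × alternatingGroup (Fin 4))) :=
  algBLift (Sum.elim
    (fun i => inclCenter k P (MonoidAlgebra.single (e.symm (Pi.mulSingle i (.ofAdd 1))) 1 - 1))
    fun j => ⟨cosetSum k P j, cosetSum_mem_center j⟩)
    (fun i => by
      have hg : e.symm (Pi.mulSingle i (.ofAdd 1)) ^ 2 ^ m i = 1 := by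
        rw [← map_pow, ← Pi.mulSingle_pow, ← ofAdd_nsmul]
        simp
      have := one_add_pow_two_pow k
        (MonoidAlgebra.single (e.symm (Pi.mulSingle i (.ofAdd 1))) 1 - 1 : MonoidAlgebra k P) (m i)
      rw [add_sub_cancel, MonoidAlgebra.single_pow, hg, one_pow, ← MonoidAlgebra.one_def,
        left_eq_add] at this
      rw [Sum.elim_inl, ← map_pow, this, map_zero])
    fun i j => Subtype.ext (cosetSum_mul_cosetSum i j)

lemma algBToCenter_algBCombination [CharP k 2]
    (e : P ≃* ∀ i : Fin s, Multiplicative (ZMod (2 ^ m i)))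
    (a : MonoidAlgebra k P × (Fin 3 → MonoidAlgebra k P)) :
    algBToCenter e (algBCombination e a) = centerCombination k P a := by
  have h : (algBToCenter e).comp (groupAlgebraToAlgB e) = inclCenter k P := by
    refine MonoidAlgebra.algHom_ext (fun p => ?_) (Subsingleton.elim _ _)
    simp only [AlgHom.comp_apply, groupAlgebraToAlgB, MonoidAlgebra.lift_single, one_smul,
      MonoidHom.comp_apply]
    refine (map_cyclicProdHom _ _ (algBToCenter (k := k) e).toMonoidHom
      (((inclCenter k P).toMonoidHom.comp (MonoidAlgebra.of k P)).comp e.symm.toMonoidHom)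
      (fun i => ?_) _).trans ?_
    · simp [algBToCenter, algBLift_algBVar]
    · simp
  have h' b : algBToCenter e (groupAlgebraToAlgB e b) = inclCenter k P b := DFunLike.congr_fun h b
  simp only [algBCombination, centerCombination, map_add, map_sum, map_mul, h']
  simp [algBToCenter, algBLift_algBVar]

end AlgB

theorem center_groupAlgebra_P_times_A4_iso
    {k : Type*} [Field k] [IsAlgClosed k] [CharP k 2]
    {P : Type*} [CommGroup P] [Finite P] {s : ℕ} (m : Fin s → ℕ)
    (hm1 : ∀ i, 1 ≤ m i)
    (hP : Nonempty (P ≃* ∀ i : Fin s, Multiplicative (ZMod (2 ^ m i)))) :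
    Nonempty
      (Subalgebra.center k (MonoidAlgebra k (P × alternatingGroup (Fin 4))) ≃ₐ[k] algB k m) := by
  obtain ⟨e⟩ := hP
  have hcomp : algBToCenter (k := k) e ∘ algBCombination e = centerCombination k P :=
    funext (algBToCenter_algBCombination e)
  have hinj : Function.Injective (algBToCenter (k := k) e) :=
    Function.Injective.of_comp_right (hcomp ▸ centerCombination_injective)
      (algBCombination_surjective hm1 e)
  have hsurj : Function.Surjective (algBToCenter (k := k) e) :=
    Function.Surjective.of_comp (hcomp ▸ centerCombination_surjective)
  exact ⟨(AlgEquiv.ofBijective _ ⟨hinj, hsurj⟩).symm⟩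
end

section
/- Let $k$ be an algebraically closed field of characteristic $2$, let $A_4$ denote the alternating group on $4$ letters, and let $P$ and $Q$ be finite abelian $2$-groups. If the centres $Z(k(P \times A_4))$ and $Z(k(Q \times A_4))$ of the group algebras $k(P \times A_4)$ and $k(Q \times A_4)$ are isomorphic as $k$-algebras, then $P \cong Q$. -/
theorem card_range_powMonoidHom_one (G : Type*) [CommGroup G] :
    Nat.card (powMonoidHom 1 : G →* G).range = Nat.card G := by
  rw [MonoidHom.range_eq_top.mpr fun x ↦ ⟨x, pow_one x⟩, Subgroup.card_top]

theorem card_range_powMonoidHom_of_mulEquiv {G : Type*} [CommGroup G] {ι : Type*} [Fintype ι]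
    {n : ι → ℕ} (hn : ∀ i, n i ≠ 0) (e : G ≃* ∀ i, Multiplicative (ZMod (n i))) (d : ℕ) :
    Nat.card (powMonoidHom d : G →* G).range = ∏ i, n i / (n i).gcd d := by
  have : ∀ i, NeZero (n i) := fun i ↦ ⟨hn i⟩
  have h₁ : Nat.card (powMonoidHom d : G →* G).range =
      Nat.card (powMonoidHom d : (∀ i, Multiplicative (ZMod (n i))) →* _).range := by
    refine Nat.card_congr (e.toEquiv.subtypeEquiv fun x ↦ ⟨?_, ?_⟩)
    · rintro ⟨y, rfl⟩
      exact ⟨e y, by simp⟩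
    · rintro ⟨y, hy⟩
      exact ⟨e.symm y, e.injective (by simpa using hy)⟩
  have h₂ : ((powMonoidHom d : (∀ i, Multiplicative (ZMod (n i))) →* _).range : Set _) =
      Set.univ.pi fun i ↦
        ((powMonoidHom d : Multiplicative (ZMod (n i)) →* Multiplicative (ZMod (n i))).range :
          Set (Multiplicative (ZMod (n i)))) := by
    simp only [MonoidHom.coe_range]
    exact Set.range_piMap fun i (x : Multiplicative (ZMod (n i))) ↦ x ^ d
  rw [h₁, ← SetLike.coe_sort_coe, h₂, Nat.card_congr (Equiv.Set.univPi _), Nat.card_pi]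
  refine Finset.prod_congr rfl fun i _ ↦ ?_
  rw [SetLike.coe_sort_coe, IsCyclic.card_powMonoidHom_range]
  simp

theorem IsPGroup.exists_mulEquiv_pi_zmod {p : ℕ} [Fact p.Prime] {G : Type*} [CommGroup G]
    [Finite G] (hG : IsPGroup p G) :
    ∃ (ι : Type) (_ : Fintype ι) (e : ι → ℕ), (∀ i, 0 < e i) ∧
      Nonempty (G ≃* ∀ i, Multiplicative (ZMod (p ^ e i))) := by
  obtain ⟨ι, _, n, hn, ⟨f⟩⟩ := CommGroup.equiv_prod_multiplicative_zmod_of_finite G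
  obtain ⟨s, hs⟩ := IsPGroup.iff_card.mp hG
  have hdvd : ∀ i, n i ∣ p ^ s := fun i ↦ by
    rw [← hs, Nat.card_congr f.toEquiv, Nat.card_pi]
    refine dvd_trans (Nat.card_zmod (n i)).symm.dvd (Finset.dvd_prod_of_mem _ (Finset.mem_univ i))
  choose e _ he using fun i ↦ (Nat.dvd_prime_pow Fact.out).mp (hdvd i)
  obtain rfl : n = fun i ↦ p ^ e i := funext he
  refine ⟨ι, inferInstance, e, fun i ↦ Nat.pos_of_ne_zero fun h ↦ ?_, ⟨f⟩⟩
  simpa [h] using hn i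

/-- The second difference of the truncated sums of `g` counts the values of `g`. -/
theorem sum_sub_add_sum_sub {α : Type*} [Fintype α] (g : α → ℕ) (m : ℕ) :
    ∑ i, (g i - m) + ∑ i, (g i - (m + 2)) =
      2 * ∑ i, (g i - (m + 1)) + Fintype.card {i // g i = m + 1} := by
  rw [Fintype.card_subtype, Finset.card_filter, Finset.mul_sum, ← Finset.sum_add_distrib,
    ← Finset.sum_add_distrib]
  refine Finset.sum_congr rfl fun i _ ↦ ?_
  split_ifs <;> omega

/-- A multiset of positive integers is determined by its truncated sums. -/
theorem exists_equiv_of_sum_sub_eq {ι κ : Type*} [Fintype ι] [Fintype κ] {e : ι → ℕ} {f : κ → ℕ}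
    (he : ∀ i, 0 < e i) (hf : ∀ j, 0 < f j)
    (h : ∀ m, ∑ i, (e i - m) = ∑ j, (f j - m)) : ∃ σ : ι ≃ κ, ∀ i, f (σ i) = e i := by
  classical
  have card_eq : ∀ m, Fintype.card {i // e i = m} = Fintype.card {j // f j = m} := by
    rintro (_ | m)
    · rw [Fintype.card_eq_zero_iff.mpr ⟨fun i ↦ (he i.1).ne' i.2⟩,
        Fintype.card_eq_zero_iff.mpr ⟨fun j ↦ (hf j.1).ne' j.2⟩]
    · have h₁ := sum_sub_add_sum_sub e m
      have h₂ := sum_sub_add_sum_sub f m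
      rw [h, h, h] at h₁
      omega
  refine ⟨Equiv.ofFiberEquiv fun m ↦ Fintype.equivOfCardEq (card_eq m), fun i ↦ ?_⟩
  exact Equiv.ofFiberEquiv_map _ i

theorem IsPGroup.nonempty_mulEquiv_of_card_range_pow_eq {p : ℕ} [Fact p.Prime] {P Q : Type*}
    [CommGroup P] [Finite P] [CommGroup Q] [Finite Q] (hP : IsPGroup p P) (hQ : IsPGroup p Q)
    (h : ∀ m, Nat.card (powMonoidHom (p ^ m) : P →* P).range =
      Nat.card (powMonoidHom (p ^ m) : Q →* Q).range) : Nonempty (P ≃* Q) := by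
  obtain ⟨ι, _, e, he, ⟨φ⟩⟩ := hP.exists_mulEquiv_pi_zmod
  obtain ⟨κ, _, f, hf, ⟨ψ⟩⟩ := hQ.exists_mulEquiv_pi_zmod
  have hp : p.Prime := Fact.out
  have quot : ∀ a m, p ^ a / (p ^ a).gcd (p ^ m) = p ^ (a - m) := fun a m ↦ by
    rcases le_total a m with ham | ham
    · rw [Nat.gcd_eq_left (pow_dvd_pow p ham), Nat.sub_eq_zero_of_le ham, pow_zero,
        Nat.div_self (pow_pos hp.pos a)]
    · rw [Nat.gcd_eq_right (pow_dvd_pow p ham), Nat.pow_div ham hp.pos]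
  obtain ⟨σ, hσ⟩ := exists_equiv_of_sum_sub_eq he hf fun m ↦ by
    have := h m
    rw [card_range_powMonoidHom_of_mulEquiv (fun i ↦ (pow_pos hp.pos (e i)).ne') φ,
      card_range_powMonoidHom_of_mulEquiv (fun j ↦ (pow_pos hp.pos (f j)).ne') ψ] at this
    simp only [quot, Finset.prod_pow_eq_pow_sum] at this
    exact Nat.pow_right_injective hp.two_le this
  have component : ∀ i, Multiplicative (ZMod (p ^ e i)) ≃* Multiplicative (ZMod (p ^ f (σ i))) :=
    fun i ↦ (ZMod.ringEquivCongr (by rw [hσ])).toAddEquiv.toMultiplicative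
  let reindex : (∀ j, Multiplicative (ZMod (p ^ f j))) ≃*
      ∀ i, Multiplicative (ZMod (p ^ f (σ i))) :=
    { (Equiv.piCongrLeft (fun j ↦ Multiplicative (ZMod (p ^ f j))) σ).symm with
      map_mul' := fun _ _ ↦ rfl }
  exact ⟨φ.trans <| (MulEquiv.piCongrRight component).trans <| reindex.symm.trans ψ.symm⟩
/-- The index of the conjugacy class of an element of `A₄`: the identity, the double
transpositions, and the two classes of 3-cycles. -/
def alternatingClass (g : alternatingGroup (Fin 4)) : Fin 4 :=
  if g = 1 then 0 else if g ^ 2 = 1 then 1 else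
    if ∃ x : alternatingGroup (Fin 4),
      (x * g * x⁻¹ : Equiv.Perm (Fin 4)) = Equiv.swap 0 1 * Equiv.swap 1 2 then 2 else 3

theorem exists_conj_of_alternatingClass_eq :
    ∀ g h, alternatingClass g = alternatingClass h → ∃ x, x * g * x⁻¹ = h := by
  decide +kernel

theorem two_dvd_card_alternatingClass : ∀ g : alternatingGroup (Fin 4), g ≠ 1 → ∀ i,
    2 ∣ (Finset.univ.filter fun h ↦
      alternatingClass h = i ∧ alternatingClass (h⁻¹ * g) = i).card := by
  decide +kernel

theorem card_alternatingClass_comm : ∀ (g : alternatingGroup (Fin 4)) (i j : Fin 4),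
    (Finset.univ.filter fun h ↦
      alternatingClass h = i ∧ alternatingClass (h⁻¹ * g) = j).card =
    (Finset.univ.filter fun h ↦
      alternatingClass h = j ∧ alternatingClass (h⁻¹ * g) = i).card := by
  decide +kernel

open Module

theorem finrank_span_range_pow_eq_of_algEquiv {k A B : Type*} [CommSemiring k] [Semiring A]
    [Algebra k A] [Semiring B] [Algebra k B] (e : A ≃ₐ[k] B) (N : ℕ) :
    finrank k (Submodule.span k (Set.range fun a : A ↦ a ^ N)) =
      finrank k (Submodule.span k (Set.range fun b : B ↦ b ^ N)) := by
  have hrange : (Set.range fun b : B ↦ b ^ N) = e.toLinearEquiv '' Set.range fun a : A ↦ a ^ N := by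
    rw [← Set.range_comp, ← e.surjective.range_comp]
    congr 1
    ext a
    simp
  exact (e.toLinearEquiv.finrank_map_eq _).symm.trans
    (by rw [hrange, Submodule.map_span]; rfl)

/-- The space of `k`-valued class functions on a group. -/
def classFunctions (k H : Type*) [Semiring k] [Group H] : Submodule k (H → k) where
  carrier := {f | ∀ g h, f (h * g * h⁻¹) = f g}
  add_mem' hf hf' g h := by simp [hf g h, hf' g h]
  zero_mem' _ _ := rfl
  smul_mem' c f hf g h := by simp [hf g h]

theorem finrank_classFunctions_pos (k H : Type*) [Field k] [Group H] [Finite H] :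
    0 < finrank k (classFunctions k H) :=
  finrank_pos_iff_exists_ne_zero.mpr
    ⟨⟨1, fun _ _ ↦ rfl⟩, fun h ↦ one_ne_zero (congrFun (congrArg Subtype.val h) 1)⟩

namespace MonoidAlgebra

variable {k G P H : Type*}

theorem mem_center_iff_coeff_mem_classFunctions [CommSemiring k] [Group G]
    {z : MonoidAlgebra k G} :
    z ∈ Subalgebra.center k (MonoidAlgebra k G) ↔ ⇑z.coeff ∈ classFunctions k G := by
  rw [Subalgebra.mem_center_iff]
  constructor
  · intro hz g h
    have := congrArg (fun x ↦ x.coeff (h * g)) (hz (single h 1))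
    simpa using this.symm
  · intro hz b
    induction b using MonoidAlgebra.induction_linear with
    | zero => simp
    | add x y hx hy => rw [add_mul, mul_add, hx, hy]
    | single h r =>
      ext g
      have := hz (h⁻¹ * g) h
      rw [coeff_single_mul_apply, coeff_mul_single_apply, ← this, mul_comm]
      simp

/-- The centre of `k[P × H]`, for `P` commutative, consists of `P`-indexed families of class
functions on `H`. -/
noncomputable def centerEquivPiClassFunctions (k P H : Type*) [CommSemiring k] [CommGroup P]
    [Finite P] [Group H] [Finite H] :
    Subalgebra.center k (MonoidAlgebra k (P × H)) ≃ₗ[k] (P → classFunctions k H) where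
  toFun z p := ⟨fun h ↦ z.1.coeff (p, h), fun g h ↦ by
    simpa using mem_center_iff_coeff_mem_classFunctions.mp z.2 (p, g) (1, h)⟩
  map_add' _ _ := rfl
  map_smul' _ _ := rfl
  invFun f := ⟨ofCoeff (Finsupp.equivFunOnFinite.symm fun x ↦ (f x.1).1 x.2),
    mem_center_iff_coeff_mem_classFunctions.mpr fun g h ↦ by
      simpa using (f g.1).2 g.2 h.2⟩
  left_inv z := by ext; rfl
  right_inv f := rfl

theorem finrank_center_prod (k P H : Type*) [Field k] [CommGroup P] [Finite P] [Group H]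
    [Finite H] : finrank k (Subalgebra.center k (MonoidAlgebra k (P × H))) =
      Nat.card P * finrank k (classFunctions k H) := by
  cases nonempty_fintype P
  rw [(centerEquivPiClassFunctions k P H).finrank_eq, finrank_pi_fintype]
  simp

theorem add_sq_of_commute_of_charTwo [CommSemiring k] [CharP k 2] [Monoid G]
    {x y : MonoidAlgebra k G} (h : Commute x y) : (x + y) ^ 2 = x ^ 2 + y ^ 2 := by
  have : (2 : MonoidAlgebra k G) = 0 := by
    rw [← map_ofNat (algebraMap k (MonoidAlgebra k G)) 2, CharTwo.two_eq_zero, map_zero]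
  rw [h.add_sq, this, zero_mul, zero_mul, add_zero]

/-- The span of the `n`-th powers of the elements of `P` in `k[P × H]`. -/
noncomputable def powSupported (k P H : Type*) [Semiring k] [CommGroup P] [Group H] (n : ℕ) :
    Submodule k (MonoidAlgebra k (P × H)) :=
  supported k k (Set.range fun p : P ↦ (p ^ n, (1 : H)))

theorem powSupported_eq_span [Semiring k] [CommGroup P] [Group H] (n : ℕ) :
    powSupported k P H n = Submodule.span k (Set.range fun p : P ↦ single (p ^ n, (1 : H)) 1) := by
  rw [powSupported, supported_eq_span_single, ← Set.range_comp]
  rfl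

theorem finrank_powSupported [Field k] [CommGroup P] [Finite P] [Group H] (n : ℕ) :
    finrank k (powSupported k P H n) = Nat.card (powMonoidHom n : P →* P).range := by
  have hrange : (Set.range fun p : P ↦ (p ^ n, (1 : H))) =
      (fun p ↦ (p, (1 : H))) '' Set.range fun p : P ↦ p ^ n := by
    rw [← Set.range_comp]; rfl
  have := Set.Finite.fintype (Set.finite_range fun p : P ↦ (p ^ n, (1 : H)))
  rw [powSupported, (supportedEquivFinsupp (R := k) (S := k) _).finrank_eq, finrank_finsupp_self,
    ← Nat.card_eq_fintype_card, hrange,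
    Nat.card_image_of_injective fun _ _ h ↦ congrArg Prod.fst h]
  rfl

theorem single_mem_center [CommSemiring k] [CommGroup P] [Group H] (p : P) (r : k) :
    single (p, (1 : H)) r ∈ Subalgebra.center k (MonoidAlgebra k (P × H)) :=
  Subalgebra.mem_center_iff.mpr fun b ↦ .symm <|
    single_commute (fun x ↦ by ext <;> simp [mul_comm]) (Commute.all r) b

theorem sq_mem_powSupported [Field k] [CharP k 2] [CommGroup P] [Group H] {n : ℕ}
    {z : MonoidAlgebra k (P × H)} (hz : z ∈ powSupported k P H n) :
    z ^ 2 ∈ powSupported k P H (n * 2) := by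
  rw [powSupported_eq_span] at hz ⊢
  suffices z ∈ Subalgebra.center k (MonoidAlgebra k (P × H)) ∧ z ^ 2 ∈ Submodule.span k
      (Set.range fun p : P ↦ single (p ^ (n * 2), (1 : H)) (1 : k)) from this.2
  induction hz using Submodule.span_induction with
  | mem x hx =>
    obtain ⟨p, rfl⟩ := hx
    exact ⟨single_mem_center _ _, Submodule.subset_span ⟨p, by simp [single_pow, pow_mul]⟩⟩
  | zero => simp
  | add x y _ _ hx hy =>
    refine ⟨add_mem hx.1 hy.1, ?_⟩
    rw [add_sq_of_commute_of_charTwo (Subalgebra.mem_center_iff.mp hy.1 x)]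
    exact add_mem hx.2 hy.2
  | smul c x _ hx =>
    rw [smul_pow]
    exact ⟨Subalgebra.smul_mem _ hx.1 c, Submodule.smul_mem _ _ hx.2⟩

/-- The element of `k[P × H]` with coefficients `f` on `{p} × H` and zero elsewhere. -/
noncomputable def ofSlice [Semiring k] [Finite P] [DecidableEq P] [Finite H] (p : P) (f : H → k) :
    MonoidAlgebra k (P × H) :=
  ofCoeff (Finsupp.equivFunOnFinite.symm fun x ↦ if x.1 = p then f x.2 else 0)

theorem coeff_ofSlice [Semiring k] [Finite P] [DecidableEq P] [Finite H] (p : P) (f : H → k)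
    (x : P × H) : (ofSlice p f).coeff x = if x.1 = p then f x.2 else 0 := rfl

theorem ofSlice_mem_center [CommSemiring k] [CommGroup P] [Finite P] [DecidableEq P] [Group H]
    [Finite H] (p : P) {f : H → k} (hf : f ∈ classFunctions k H) :
    ofSlice p f ∈ Subalgebra.center k (MonoidAlgebra k (P × H)) :=
  mem_center_iff_coeff_mem_classFunctions.mpr fun g h ↦ by
    simp [coeff_ofSlice, hf g.2 h.2]

theorem ofSlice_sq_mem_powSupported [CommSemiring k] [CommGroup P] [Finite P] [DecidableEq P]
    [Group H] [Fintype H] (p : P) {f : H → k}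
    (hf : ∀ g ≠ 1, ∑ h, f h * f (h⁻¹ * g) = 0) : ofSlice p f ^ 2 ∈ powSupported k P H 2 := by
  cases nonempty_fintype P
  refine mem_supported'.mpr fun x hx ↦ ?_
  rw [sq, coeff_mul_apply_left, Finsupp.sum_fintype _ _ (by simp), Fintype.sum_prod_type,
    Fintype.sum_eq_single p fun q hq ↦ by simp [coeff_ofSlice, hq]]
  simp only [coeff_ofSlice, Prod.fst_mul, Prod.fst_inv, Prod.snd_mul, Prod.snd_inv, if_true]
  split_ifs with h
  · refine hf _ fun h₁ ↦ hx ⟨p, Prod.ext ?_ h₁.symm⟩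
    simp only [sq]
    exact (inv_mul_eq_iff_eq_mul.mp h).symm
  · simp

theorem center_sq_mem_powSupported [Field k] [CharP k 2] [CommGroup P] [Finite P] [Group H]
    [Fintype H] (hH : ∀ f ∈ classFunctions k H, ∀ g ≠ 1, ∑ h, f h * f (h⁻¹ * g) = 0)
    {z : MonoidAlgebra k (P × H)} (hz : z ∈ Subalgebra.center k (MonoidAlgebra k (P × H))) :
    z ^ 2 ∈ powSupported k P H 2 := by
  classical
  cases nonempty_fintype P
  have hf : ∀ p, (fun h ↦ z.coeff (p, h)) ∈ classFunctions k H := fun p ↦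
    (centerEquivPiClassFunctions k P H ⟨z, hz⟩ p).2
  have hsum : z = ∑ p, ofSlice p fun h ↦ z.coeff (p, h) := by
    ext x
    simp [coeff_sum, Finsupp.finsetSum_apply, coeff_ofSlice]
  rw [hsum]
  generalize (Finset.univ : Finset P) = s
  induction s using Finset.induction_on with
  | empty => simp
  | insert p s hp ih =>
    rw [Finset.sum_insert hp, add_sq_of_commute_of_charTwo
      (Subalgebra.mem_center_iff.mp (ofSlice_mem_center p (hf p)) _).symm]
    exact add_mem (ofSlice_sq_mem_powSupported p (hH _ (hf p))) ih

/-- If the class functions on `H` square to multiples of the identity under convolution, then the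
`2 ^ (m + 1)`-th powers of central elements of `k[P × H]` span the same space as those of the
elements of `P`. -/
theorem map_span_range_center_pow [Field k] [CharP k 2] [CommGroup P] [Finite P] [Group H]
    [Fintype H] (hH : ∀ f ∈ classFunctions k H, ∀ g ≠ 1, ∑ h, f h * f (h⁻¹ * g) = 0) (m : ℕ) :
    (Submodule.span k (Set.range fun z : Subalgebra.center k (MonoidAlgebra k (P × H)) ↦
      z ^ 2 ^ (m + 1))).map (Subalgebra.center k (MonoidAlgebra k (P × H))).val.toLinearMap =
      powSupported k P H (2 ^ (m + 1)) := by
  rw [Submodule.map_span, ← Set.range_comp]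
  refine le_antisymm (Submodule.span_le.mpr ?_) ?_
  · rintro _ ⟨z, rfl⟩
    change z.1 ^ 2 ^ (m + 1) ∈ powSupported k P H (2 ^ (m + 1))
    induction m with
    | zero => simpa using center_sq_mem_powSupported hH z.2
    | succ m ih =>
      rw [pow_succ 2 (m + 1), pow_mul]
      exact sq_mem_powSupported ih
  · rw [powSupported_eq_span]
    refine Submodule.span_mono ?_
    rintro _ ⟨p, rfl⟩
    exact ⟨⟨single (p, 1) 1, single_mem_center p 1⟩, by simp [single_pow]⟩

theorem finrank_span_range_center_pow [Field k] [CharP k 2] [CommGroup P] [Finite P] [Group H]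
    [Fintype H] (hH : ∀ f ∈ classFunctions k H, ∀ g ≠ 1, ∑ h, f h * f (h⁻¹ * g) = 0) (m : ℕ) :
    finrank k (Submodule.span k (Set.range fun z : Subalgebra.center k (MonoidAlgebra k (P × H)) ↦
      z ^ 2 ^ (m + 1))) = Nat.card (powMonoidHom (2 ^ (m + 1)) : P →* P).range := by
  rw [← finrank_powSupported (k := k) (H := H), ← map_span_range_center_pow hH]
  exact (Submodule.equivMapOfInjective _ Subtype.val_injective _).finrank_eq

end MonoidAlgebra

/-- In characteristic two, the convolution square of a class function on `A₄` is supported at the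
identity. -/
theorem sum_mul_eq_zero_of_mem_classFunctions {k : Type*} [CommRing k] [CharP k 2]
    {f : alternatingGroup (Fin 4) → k} (hf : f ∈ classFunctions k (alternatingGroup (Fin 4)))
    {g : alternatingGroup (Fin 4)} (hg : g ≠ 1) : ∑ h, f h * f (h⁻¹ * g) = 0 := by
  obtain ⟨F, hF⟩ : ∃ F : Fin 4 → k, ∀ h, f h = F (alternatingClass h) := by
    have : Function.FactorsThrough f alternatingClass := fun g h hgh ↦ by
      obtain ⟨x, rfl⟩ := exists_conj_of_alternatingClass_eq g h hgh
      exact (hf g x).symm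
    exact ⟨Function.extend alternatingClass f 0, fun h ↦ (this.extend_apply 0 h).symm⟩
  have hfiber : ∑ h, f h * f (h⁻¹ * g) = ∑ ij : Fin 4 × Fin 4,
      ((Finset.univ.filter fun h ↦ alternatingClass h = ij.1 ∧
        alternatingClass (h⁻¹ * g) = ij.2).card : k) * (F ij.1 * F ij.2) := by
    rw [← Finset.sum_fiberwise Finset.univ
      fun h ↦ (alternatingClass h, alternatingClass (h⁻¹ * g))]
    refine Finset.sum_congr rfl fun ij _ ↦ ?_
    rw [← nsmul_eq_mul, ← Finset.sum_const]
    refine Finset.sum_congr (by simp [Prod.ext_iff]) fun h hh ↦ ?_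
    obtain ⟨-, h₁, h₂⟩ := Finset.mem_filter.mp hh
    rw [hF, hF, h₁, h₂]
  rw [hfiber]
  refine Finset.sum_involution (fun ij _ ↦ ij.swap) (fun ij _ ↦ ?_) (fun ij _ hne heq ↦ hne ?_)
    (fun _ _ ↦ Finset.mem_univ _) fun ij _ ↦ ij.swap_swap
  · rw [Prod.fst_swap, Prod.snd_swap, card_alternatingClass_comm, mul_comm (F ij.2)]
    exact CharTwo.add_self_eq_zero _
  · obtain ⟨i, j⟩ := ij
    obtain rfl : j = i := congrArg Prod.fst heq
    rw [(CharP.cast_eq_zero_iff k 2 _).mpr (two_dvd_card_alternatingClass g hg j), zero_mul]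

theorem center_iso_implies_group_iso
    {k : Type*} [Field k] [IsAlgClosed k] [CharP k 2]
    {P Q : Type*} [CommGroup P] [Finite P] [CommGroup Q] [Finite Q]
    (hP : IsPGroup 2 P) (hQ : IsPGroup 2 Q)
    (h : Nonempty
      (Subalgebra.center k (MonoidAlgebra k (P × alternatingGroup (Fin 4))) ≃ₐ[k]
        Subalgebra.center k (MonoidAlgebra k (Q × alternatingGroup (Fin 4))))) :
    Nonempty (P ≃* Q) := by
  obtain ⟨e⟩ := h
  have hA₄ : ∀ f ∈ classFunctions k (alternatingGroup (Fin 4)), ∀ g ≠ 1,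
      ∑ h, f h * f (h⁻¹ * g) = 0 := fun _ hf _ hg ↦ sum_mul_eq_zero_of_mem_classFunctions hf hg
  refine hP.nonempty_mulEquiv_of_card_range_pow_eq hQ fun m ↦ ?_
  cases m with
  | zero =>
    have hcard := e.toLinearEquiv.finrank_eq
    rw [MonoidAlgebra.finrank_center_prod, MonoidAlgebra.finrank_center_prod] at hcard
    rw [pow_zero, card_range_powMonoidHom_one, card_range_powMonoidHom_one]
    exact Nat.eq_of_mul_eq_mul_right (finrank_classFunctions_pos k _) hcard
  | succ m =>
    rw [← MonoidAlgebra.finrank_span_range_center_pow hA₄,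
      ← MonoidAlgebra.finrank_span_range_center_pow hA₄]
    exact finrank_span_range_pow_eq_of_algEquiv e _
end
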